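/- arXiv:0811.3896 — 3 statements merged into one kernel-verified Lean document; each statement's English description precedes it below -/
import Mathlib

section
/- Let D = {v₁,…,v_m} be a set of m points in ℤ² whose pairwise differences between distinct points are all distinct (a DD(m)), and let k be a positive integer. Then C_k(D) = ∑_{i=1}^k |H_i| if and only if ∑_{i=1}^m c_i v_i ≠ 0 for every (c₁,…,c_m) ∈ ⋃_{i=1}^{2k} H_i. -/
/-- All differences of distinct pairs of points of `D` are pairwise distinct. -/
def HasDistinctDifferences {G : Type*} [AddCommGroup G] (D : Set G) : Prop :=
  ∀ v ∈ D, ∀ w ∈ D, ∀ v' ∈ D, ∀ w' ∈ D,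
    v ≠ w → v' ≠ w' → v - w = v' - w' → v = v' ∧ w = w'

/-- The set of nonzero elements expressible as a sum of at most `k` difference
vectors of `D`. -/
def khopSet {G : Type*} [AddCommGroup G] (D : Set G) (k : ℕ) : Set G :=
  {x | x ≠ 0 ∧ ∃ ℓ : ℕ, ℓ ≤ k ∧ ∃ a b : Fin ℓ → G,
    (∀ i, a i ∈ D ∧ b i ∈ D ∧ a i ≠ b i) ∧ x = ∑ i, (a i - b i)}

/-- `Ck D k` is the `k`-hop coverage of `D`. -/
noncomputable def Ck {G : Type*} [AddCommGroup G] (D : Set G) (k : ℕ) : ℕ :=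
  (khopSet D k).ncard

/-- `H m k` is the set of m-tuples of integers summing to 0 whose positive
entries sum to `k`. -/
def H (m k : ℕ) : Set (Fin m → ℤ) :=
  {a | ∑ i, a i = 0 ∧ ∑ i ∈ Finset.univ.filter (fun i => 0 < a i), a i = (k : ℤ)}

/-- The sum of the positive parts of the entries of `c`. -/
def posSum {m : ℕ} (c : Fin m → ℤ) : ℤ := ∑ i, max (c i) 0

/-- The integer tuples with sum zero whose positive entries sum to at most `k`. -/
def zeroSumBall (m k : ℕ) : Set (Fin m → ℤ) := {c | ∑ i, c i = 0 ∧ posSum c ≤ k}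

theorem mem_H_iff {m k : ℕ} {c : Fin m → ℤ} : c ∈ H m k ↔ ∑ i, c i = 0 ∧ posSum c = k := by
  have h : ∑ i ∈ Finset.univ.filter (fun i => 0 < c i), c i = posSum c := by
    rw [Finset.sum_filter]
    refine Finset.sum_congr rfl fun i _ => ?_
    split_ifs <;> omega
  simp only [H, Set.mem_ofPred_eq, h]

theorem posSum_nonneg {m : ℕ} (c : Fin m → ℤ) : 0 ≤ posSum c :=
  Finset.sum_nonneg fun _ _ => le_max_right _ _

theorem le_posSum {m : ℕ} (c : Fin m → ℤ) (i : Fin m) : c i ≤ posSum c :=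
  (le_max_left _ _).trans
    (Finset.single_le_sum (f := fun i => max (c i) 0) (fun _ _ => le_max_right _ _)
      (Finset.mem_univ i))

theorem posSum_add_le {m : ℕ} (c d : Fin m → ℤ) : posSum (c + d) ≤ posSum c + posSum d := by
  simp only [posSum, ← Finset.sum_add_distrib]
  refine Finset.sum_le_sum fun i _ => ?_
  simp only [Pi.add_apply]
  omega

theorem posSum_neg {m : ℕ} {c : Fin m → ℤ} (hc : ∑ i, c i = 0) : posSum (-c) = posSum c := by
  have h : posSum (-c) = posSum c - ∑ i, c i := by
    simp only [posSum, ← Finset.sum_sub_distrib]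
    refine Finset.sum_congr rfl fun i _ => ?_
    simp only [Pi.neg_apply]
    omega
  rw [h, hc, sub_zero]

theorem posSum_zero {m : ℕ} : posSum (0 : Fin m → ℤ) = 0 := by simp [posSum]

theorem zero_mem_zeroSumBall (m k : ℕ) : (0 : Fin m → ℤ) ∈ zeroSumBall m k :=
  ⟨by simp, by simp [posSum_zero]⟩

theorem add_mem_zeroSumBall {m k l : ℕ} {c d : Fin m → ℤ} (hc : c ∈ zeroSumBall m k)
    (hd : d ∈ zeroSumBall m l) : c + d ∈ zeroSumBall m (k + l) := by
  refine ⟨by simp [Finset.sum_add_distrib, hc.1, hd.1], (posSum_add_le c d).trans ?_⟩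
  push_cast
  exact add_le_add hc.2 hd.2

theorem neg_mem_zeroSumBall {m k : ℕ} {c : Fin m → ℤ} (hc : c ∈ zeroSumBall m k) :
    -c ∈ zeroSumBall m k :=
  ⟨by simp [hc.1], (posSum_neg hc.1).trans_le hc.2⟩

theorem zeroSumBall_mono {m k l : ℕ} (h : k ≤ l) : zeroSumBall m k ⊆ zeroSumBall m l :=
  fun _ hc => ⟨hc.1, hc.2.trans (by exact_mod_cast h)⟩

theorem single_sub_single_mem_zeroSumBall {m : ℕ} (i j : Fin m) :
    Pi.single i 1 - Pi.single j 1 ∈ zeroSumBall m 1 := by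
  refine ⟨by simp [Finset.sum_sub_distrib], ?_⟩
  have h : ∑ x, (Pi.single i 1 : Fin m → ℤ) x = 1 := by simp
  rw [Nat.cast_one, ← h]
  refine Finset.sum_le_sum fun x _ => ?_
  simp only [Pi.sub_apply, Pi.single_apply]
  split_ifs <;> simp

theorem posSum_pos {m : ℕ} {c : Fin m → ℤ} (hc : ∑ i, c i = 0) (h0 : c ≠ 0) :
    0 < posSum c := by
  obtain ⟨i, hi⟩ := Function.ne_iff.mp h0
  obtain ⟨j, -, hj⟩ :=
    Finset.exists_pos_of_sum_zero_of_exists_nonzero c hc ⟨i, Finset.mem_univ i, hi⟩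
  exact hj.trans_le (le_posSum c j)

theorem zeroSumBall_zero (m : ℕ) : zeroSumBall m 0 = {0} := by
  refine Set.Subset.antisymm (fun c hc => ?_)
    (Set.singleton_subset_iff.mpr (zero_mem_zeroSumBall m 0))
  by_contra h0
  exact absurd hc.2 (not_le.mpr (by simpa using posSum_pos hc.1 h0))

/-- A nonzero tuple in the ball of radius `k + 1` moves into the ball of radius `k` after
subtracting a suitable difference of two unit vectors. -/
theorem exists_sub_mem_zeroSumBall {m k : ℕ} {c : Fin m → ℤ} (hc : c ∈ zeroSumBall m (k + 1))
    (h0 : c ≠ 0) :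
    ∃ i j, i ≠ j ∧ c - (Pi.single i 1 - Pi.single j 1) ∈ zeroSumBall m k := by
  obtain ⟨x, hx⟩ := Function.ne_iff.mp h0
  obtain ⟨i, -, hi⟩ :=
    Finset.exists_pos_of_sum_zero_of_exists_nonzero c hc.1 ⟨x, Finset.mem_univ x, hx⟩
  obtain ⟨j, -, hj⟩ :=
    Finset.exists_pos_of_sum_zero_of_exists_nonzero (-c) (by simp [hc.1])
      ⟨x, Finset.mem_univ x, by simpa using hx⟩
  rw [Pi.neg_apply] at hj
  have hij : i ≠ j := by rintro rfl; omega
  refine ⟨i, j, hij, by simp [Finset.sum_sub_distrib, hc.1], ?_⟩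
  have h : posSum (c - (Pi.single i 1 - Pi.single j 1)) ≤
      posSum c - ∑ x, (Pi.single i 1 : Fin m → ℤ) x := by
    simp only [posSum, ← Finset.sum_sub_distrib]
    refine Finset.sum_le_sum fun y _ => ?_
    simp only [Pi.sub_apply, Pi.single_apply]
    split_ifs with h₁ h₂ h₂
    · exact absurd (h₁.symm.trans h₂) hij
    · subst h₁; omega
    · subst h₂; omega
    · omega
  have h₂ := hc.2
  simp only [Finset.sum_pi_single', Finset.mem_univ, if_true] at h
  push_cast at h₂
  linarith

theorem exists_eq_add_of_mem_zeroSumBall {m k l : ℕ} {c : Fin m → ℤ}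
    (hc : c ∈ zeroSumBall m (k + l)) :
    ∃ a ∈ zeroSumBall m k, ∃ b ∈ zeroSumBall m l, c = a + b := by
  induction l generalizing c with
  | zero => exact ⟨c, hc, 0, zero_mem_zeroSumBall m 0, by simp⟩
  | succ l ih =>
    by_cases h0 : c = 0
    · exact ⟨0, zero_mem_zeroSumBall _ _, 0, zero_mem_zeroSumBall _ _, by simp [h0]⟩
    obtain ⟨i, j, -, h⟩ := exists_sub_mem_zeroSumBall hc h0
    obtain ⟨a, ha, b, hb, hab⟩ := ih h
    refine ⟨a, ha, b + (Pi.single i 1 - Pi.single j 1),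
      add_mem_zeroSumBall hb (single_sub_single_mem_zeroSumBall i j), ?_⟩
    rw [← add_assoc, ← hab, sub_add_cancel]

theorem exists_eq_sum_of_mem_zeroSumBall {m k : ℕ} {c : Fin m → ℤ} (hc : c ∈ zeroSumBall m k) :
    ∃ ℓ ≤ k, ∃ a b : Fin ℓ → Fin m, (∀ t, a t ≠ b t) ∧
      c = ∑ t, (Pi.single (a t) 1 - Pi.single (b t) 1) := by
  induction k generalizing c with
  | zero =>
    rw [zeroSumBall_zero] at hc
    exact ⟨0, le_rfl, Fin.elim0, Fin.elim0, fun t => t.elim0, by simpa using hc⟩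
  | succ k ih =>
    by_cases h0 : c = 0
    · exact ⟨0, Nat.zero_le _, Fin.elim0, Fin.elim0, fun t => t.elim0, by simpa using h0⟩
    obtain ⟨i, j, hij, h⟩ := exists_sub_mem_zeroSumBall hc h0
    obtain ⟨ℓ, hℓ, a, b, hab, hsum⟩ := ih h
    refine ⟨ℓ + 1, by omega, Fin.cons i a, Fin.cons j b, fun t => ?_, ?_⟩
    · refine Fin.cases ?_ (fun t => ?_) t
      · simpa using hij
      · simpa using hab t
    · simp only [Fin.sum_univ_succ, Fin.cons_zero, Fin.cons_succ, ← hsum, add_sub_cancel]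

theorem sum_single_sub_single_mem_zeroSumBall {m ℓ : ℕ} (a b : Fin ℓ → Fin m) :
    ∑ t, (Pi.single (a t) 1 - Pi.single (b t) 1) ∈ zeroSumBall m ℓ := by
  induction ℓ with
  | zero => simpa using zero_mem_zeroSumBall m 0
  | succ ℓ ih =>
    rw [Fin.sum_univ_castSucc]
    exact add_mem_zeroSumBall (ih _ _) (single_sub_single_mem_zeroSumBall _ _)

theorem finite_zeroSumBall (m k : ℕ) : (zeroSumBall m k).Finite := by
  refine (Set.finite_Icc (fun _ => -(k : ℤ)) (fun _ : Fin m => (k : ℤ))).subset fun c hc => ?_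
  refine ⟨fun i => ?_, fun i => (le_posSum c i).trans hc.2⟩
  have h := (le_posSum (-c) i).trans (neg_mem_zeroSumBall hc).2
  exact neg_le.mp h

theorem ncard_zeroSumBall (m k : ℕ) :
    (zeroSumBall m k).ncard = ∑ i ∈ Finset.Icc 1 k, (H m i).ncard + 1 := by
  induction k with
  | zero => simp [zeroSumBall_zero]
  | succ k ih =>
    have hunion : zeroSumBall m (k + 1) = zeroSumBall m k ∪ H m (k + 1) := by
      ext c
      simp only [zeroSumBall, Set.mem_union, Set.mem_ofPred_eq, mem_H_iff, ← and_or_left]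
      push_cast
      exact and_congr_right fun _ => by omega
    have hdisj : Disjoint (zeroSumBall m k) (H m (k + 1)) := by
      rw [Set.disjoint_left]
      intro c hc hH
      have h₁ := hc.2
      have h₂ := (mem_H_iff.mp hH).2
      push_cast at h₂
      omega
    have hfin : (H m (k + 1)).Finite :=
      (finite_zeroSumBall m (k + 1)).subset (hunion ▸ Set.subset_union_right)
    rw [hunion, Set.ncard_union_eq hdisj (finite_zeroSumBall m k) hfin, ih,
      Finset.sum_Icc_succ_top (by omega)]
    omega

theorem mem_iUnion_H_iff {m k : ℕ} {c : Fin m → ℤ} :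
    c ∈ ⋃ i ∈ Finset.Icc 1 k, H m i ↔ c ∈ zeroSumBall m k ∧ c ≠ 0 := by
  simp only [Set.mem_iUnion, Finset.mem_Icc, mem_H_iff, exists_prop]
  constructor
  · rintro ⟨i, ⟨h₁, hk⟩, hs, hp⟩
    refine ⟨⟨hs, by rw [hp]; exact_mod_cast hk⟩, ?_⟩
    rintro rfl
    rw [posSum_zero] at hp
    omega
  · rintro ⟨⟨hs, hp⟩, h0⟩
    have hpos := posSum_pos hs h0
    exact ⟨(posSum c).toNat, by omega, hs, by omega⟩

theorem khopSet_range_eq {G : Type*} [AddCommGroup G] {m : ℕ} (k : ℕ) {v : Fin m → G}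
    (hv : Function.Injective v) :
    khopSet (Set.range v) k = Fintype.linearCombination ℤ v '' zeroSumBall m k \ {0} := by
  ext x
  simp only [khopSet, Set.mem_ofPred_eq, Set.mem_sdiff, Set.mem_singleton_iff, and_comm (a := x ≠ 0)]
  refine and_congr_left fun _ => ⟨?_, ?_⟩
  · rintro ⟨ℓ, hℓ, a, b, hab, rfl⟩
    choose a' ha' using fun t => (hab t).1
    choose b' hb' using fun t => (hab t).2.1
    refine ⟨_, zeroSumBall_mono hℓ (sum_single_sub_single_mem_zeroSumBall a' b'), ?_⟩
    simp [map_sum, map_sub, Fintype.linearCombination_apply_single, ha', hb']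
  · rintro ⟨c, hc, rfl⟩
    obtain ⟨ℓ, hℓ, a, b, hab, rfl⟩ := exists_eq_sum_of_mem_zeroSumBall hc
    refine ⟨ℓ, hℓ, v ∘ a, v ∘ b, fun t => ⟨⟨_, rfl⟩, ⟨_, rfl⟩, hv.ne (hab t)⟩, ?_⟩
    simp [map_sum, map_sub, Fintype.linearCombination_apply_single]

theorem injOn_zeroSumBall_iff {G : Type*} [AddCommGroup G] {m k : ℕ} (f : (Fin m → ℤ) →ₗ[ℤ] G) :
    Set.InjOn f (zeroSumBall m k) ↔ ∀ c ∈ zeroSumBall m (2 * k), c ≠ 0 → f c ≠ 0 := by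
  rw [two_mul]
  constructor
  · intro h c hc h0 hfc
    obtain ⟨a, ha, b, hb, rfl⟩ := exists_eq_add_of_mem_zeroSumBall hc
    have hab : f a = f (-b) := by rwa [map_neg, ← add_eq_zero_iff_eq_neg, ← map_add]
    exact h0 (add_eq_zero_iff_eq_neg.mpr (h ha (neg_mem_zeroSumBall hb) hab))
  · intro h a ha b hb hab
    by_contra hne
    refine h (a - b) ?_ (sub_ne_zero.mpr hne) (by rw [map_sub, hab, sub_self])
    rw [sub_eq_add_neg]
    exact add_mem_zeroSumBall ha (neg_mem_zeroSumBall hb)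

theorem stmt9 (m k : ℕ) (hk : 1 ≤ k) (v : Fin m → ℤ × ℤ) (hinj : Function.Injective v)
    (hdd : HasDistinctDifferences (Set.range v)) :
    Ck (Set.range v) k = ∑ i ∈ Finset.Icc 1 k, (H m i).ncard ↔
      ∀ c ∈ ⋃ i ∈ Finset.Icc 1 (2 * k), H m i, ∑ i, c i • v i ≠ 0 := by
  have hmem : (0 : ℤ × ℤ) ∈ Fintype.linearCombination ℤ v '' zeroSumBall m k :=
    ⟨0, zero_mem_zeroSumBall m k, map_zero _⟩
  have hfin := (finite_zeroSumBall m k).image (Fintype.linearCombination ℤ v)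
  have hcard := Set.ncard_sdiff_singleton_add_one hmem hfin
  rw [← khopSet_range_eq k hinj] at hcard
  have hiff : Ck (Set.range v) k = ∑ i ∈ Finset.Icc 1 k, (H m i).ncard ↔
      (Fintype.linearCombination ℤ v '' zeroSumBall m k).ncard = (zeroSumBall m k).ncard := by
    rw [← hcard, ncard_zeroSumBall, Ck, Nat.add_right_cancel_iff]
  rw [hiff, Set.ncard_image_iff (finite_zeroSumBall m k), injOn_zeroSumBall_iff]
  simp only [mem_iUnion_H_iff, and_imp, Fintype.linearCombination_apply]
end

section
/- Let k ≥ 2 be a fixed integer and let v₁, v₂, …, v_m be elements of ℤ². Then v₁,…,v_m form a B₂ₖ sequence over ℤ² (all sums v_{i₁}+⋯+v_{i₂ₖ} with 1 ≤ i₁ ≤ ⋯ ≤ i₂ₖ ≤ m are distinct) if and only if the points v₁,…,v_m are pairwise distinct, their set D is a DD(m) (all differences v_i − v_j with i ≠ j are pairwise distinct), and D has maximal k-hop coverage, i.e. C_k(D) = ∑_{i=1}^k |H_i|. -/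
/-- `v₁, …, v_m` is a `B_h` sequence: all sums of `h` of the `v_i` (with
repetition allowed, i.e. indexed by multisets of indices of size `h`) are
distinct. -/
def IsBhSeq {G : Type*} [AddCommGroup G] {m : ℕ} (h : ℕ) (v : Fin m → G) : Prop :=
  ∀ s t : Multiset (Fin m), Multiset.card s = h → Multiset.card t = h →
    (s.map v).sum = (t.map v).sum → s = t

/-- The differences of the multiplicity vectors of two multisets of indices of equal size at
most `k`. -/
def countDiffs (m k : ℕ) : Set (Fin m → ℤ) :=
  {a | ∃ s t : Multiset (Fin m), Multiset.card s = Multiset.card t ∧ Multiset.card s ≤ k ∧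
    a = fun i => (s.count i : ℤ) - t.count i}

theorem zero_mem_countDiffs (m k : ℕ) : (0 : Fin m → ℤ) ∈ countDiffs m k :=
  ⟨0, 0, rfl, by simp, by ext; simp⟩

theorem finite_countDiffs (m k : ℕ) : (countDiffs m k).Finite := by
  refine (Set.finite_Icc (fun _ => -(k : ℤ)) (fun _ => (k : ℤ))).subset ?_
  rintro _ ⟨s, t, hst, hk, rfl⟩
  have hs := fun i => s.count_le_card i
  have ht := fun i => t.count_le_card i
  refine ⟨fun i => ?_, fun i => ?_⟩ <;> grind

theorem exists_mem_H_of_mem_countDiffs {m k : ℕ} {a : Fin m → ℤ} (ha : a ∈ countDiffs m k) :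
    ∃ i ≤ k, a ∈ H m i := by
  obtain ⟨s, t, hst, hk, rfl⟩ := ha
  have hcard (u : Multiset (Fin m)) : ∑ i, (u.count i : ℤ) = Multiset.card u := by
    exact_mod_cast Multiset.sum_count_eq_card (s := Finset.univ) (by simp)
  set p := ∑ i ∈ Finset.univ.filter (fun i => 0 < (s.count i : ℤ) - t.count i),
    ((s.count i : ℤ) - t.count i) with hp
  have hp0 : 0 ≤ p := Finset.sum_nonneg fun i hi => (Finset.mem_filter.1 hi).2.le
  have hpk : p ≤ k := calc
    p ≤ ∑ i ∈ Finset.univ.filter (fun i => 0 < (s.count i : ℤ) - t.count i), (s.count i : ℤ) :=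
      Finset.sum_le_sum fun i _ => by simp
    _ ≤ ∑ i, (s.count i : ℤ) :=
      Finset.sum_le_sum_of_subset_of_nonneg (Finset.filter_subset _ _) fun _ _ _ => by simp
    _ ≤ k := by rw [hcard]; exact_mod_cast hk
  exact ⟨p.toNat, by omega, by rw [Finset.sum_sub_distrib, hcard, hcard, hst, sub_self],
    by rw [Int.toNat_of_nonneg hp0]⟩

theorem mem_countDiffs_of_mem_H {m k i : ℕ} (hi : i ≤ k) {a : Fin m → ℤ} (ha : a ∈ H m i) :
    a ∈ countDiffs m k := by
  obtain ⟨h0, hpos⟩ := ha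
  have hcount (f : Fin m → ℕ) (j : Fin m) :
      (∑ l, Multiset.replicate (f l) l).count j = f j := by
    simp [Multiset.count_sum', Multiset.count_replicate]
  have hpos' : ∑ j, ((a j).toNat : ℤ) = i := by
    rw [← hpos, Finset.sum_filter]
    exact Finset.sum_congr rfl fun j _ => by split_ifs <;> omega
  have hneg : ∑ j, ((-a j).toNat : ℤ) = i := by
    rw [← hpos', ← sub_eq_zero, ← neg_eq_zero, ← h0, neg_sub, ← Finset.sum_sub_distrib]
    exact Finset.sum_congr rfl fun j _ => by omega
  have hs : ∑ j, (a j).toNat = i := by exact_mod_cast hpos'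
  have ht : ∑ j, (-a j).toNat = i := by exact_mod_cast hneg
  refine ⟨∑ l, Multiset.replicate (a l).toNat l, ∑ l, Multiset.replicate (-a l).toNat l,
    ?_, ?_, ?_⟩
  · simp [hs, ht]
  · simpa [hs] using hi
  · ext j
    simp only [hcount]
    omega

theorem eq_zero_of_mem_H_zero {m : ℕ} {a : Fin m → ℤ} (ha : a ∈ H m 0) : a = 0 := by
  obtain ⟨s, t, hst, hs, rfl⟩ := mem_countDiffs_of_mem_H le_rfl ha
  have hs0 : s = 0 := by simpa using hs
  subst hs0
  have ht0 : t = 0 := by simpa using hst.symm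
  subst ht0
  ext
  simp

theorem zero_notMem_H {m i : ℕ} (hi : 1 ≤ i) : (0 : Fin m → ℤ) ∉ H m i := by
  rintro ⟨-, h⟩
  simp at h
  omega

theorem countDiffs_diff_zero (m k : ℕ) :
    countDiffs m k \ {0} = ⋃ i ∈ Finset.Icc 1 k, H m i := by
  ext a
  simp only [Set.mem_sdiff, Set.mem_singleton_iff, Set.mem_iUnion, Finset.mem_Icc, exists_prop]
  constructor
  · rintro ⟨ha, h0⟩
    obtain ⟨i, hi, hai⟩ := exists_mem_H_of_mem_countDiffs ha
    refine ⟨i, ⟨Nat.one_le_iff_ne_zero.2 ?_, hi⟩, hai⟩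
    rintro rfl
    exact h0 (eq_zero_of_mem_H_zero hai)
  · rintro ⟨i, ⟨h1, hi⟩, hai⟩
    refine ⟨mem_countDiffs_of_mem_H hi hai, ?_⟩
    rintro rfl
    exact zero_notMem_H h1 hai

theorem finite_H (m i : ℕ) : (H m i).Finite :=
  (finite_countDiffs m i).subset fun _ => mem_countDiffs_of_mem_H le_rfl

theorem sum_ncard_H (m k : ℕ) :
    ∑ i ∈ Finset.Icc 1 k, (H m i).ncard = (countDiffs m k).ncard - 1 := by
  rw [← Set.ncard_sdiff_singleton_of_mem (zero_mem_countDiffs m k), countDiffs_diff_zero]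
  have hdisj : Pairwise (Function.onFun Disjoint (H m)) := fun i j hij =>
    Set.disjoint_left.2 fun a hi hj => hij (by exact_mod_cast hi.2.symm.trans hj.2)
  induction Finset.Icc 1 k using Finset.induction_on with
  | empty => simp
  | insert i u hi ih =>
    rw [Finset.sum_insert hi, ih, Finset.set_biUnion_insert]
    refine (Set.ncard_union_eq ?_ (finite_H m i)
      (u.finite_toSet.biUnion fun j _ => finite_H m j)).symm
    refine Set.disjoint_iUnion₂_right.2 fun j hj => hdisj ?_
    rintro rfl
    exact hi hj

theorem exists_add_eq_of_card_eq_add {α : Type*} {s : Multiset α} {a b : ℕ}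
    (hs : Multiset.card s = a + b) :
    ∃ s₁ s₂, s = s₁ + s₂ ∧ Multiset.card s₁ = a ∧ Multiset.card s₂ = b := by
  induction s using Quotient.inductionOn with
  | h l =>
    have hl : l.length = a + b := by simpa using hs
    refine ⟨l.take a, l.drop a, ?_, ?_, ?_⟩
    · simp
    · simp [hl]
    · simp [hl]

section

variable {G : Type*} [AddCommGroup G] {m : ℕ}

theorem sum_count_sub_count_smul (v : Fin m → G) (s t : Multiset (Fin m)) :
    ∑ i, ((s.count i : ℤ) - t.count i) • v i = (s.map v).sum - (t.map v).sum := by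
  have h (u : Multiset (Fin m)) : (u.map v).sum = ∑ i, (u.count i : ℤ) • v i := by
    rw [Finset.sum_multiset_map_count]
    simp only [natCast_zsmul]
    exact Finset.sum_subset (Finset.subset_univ _) fun i _ hi => by
      simp [Multiset.count_eq_zero.2 (mt Multiset.mem_toFinset.2 hi)]
  simp only [h, sub_smul, Finset.sum_sub_distrib]

theorem exists_sum_sub_eq (v : Fin m → G) (n : ℕ) :
    ∀ s t : Multiset (Fin m), Multiset.card s = n → Multiset.card t = n →
      ∃ ℓ ≤ n, ∃ a b : Fin ℓ → G,
        (∀ i, a i ∈ Set.range v ∧ b i ∈ Set.range v ∧ a i ≠ b i) ∧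
          (s.map v).sum - (t.map v).sum = ∑ i, (a i - b i) := by
  induction n with
  | zero =>
    intro s t hs ht
    rw [Multiset.card_eq_zero] at hs ht
    subst hs ht
    exact ⟨0, le_rfl, 0, 0, fun i => i.elim0, by simp⟩
  | succ n ih =>
    intro s t hs ht
    obtain ⟨i, s, rfl⟩ : ∃ i s', s = i ::ₘ s' := by
      obtain ⟨i, hi⟩ := Multiset.card_pos_iff_exists_mem.1 (by omega : 0 < Multiset.card s)
      exact ⟨i, Multiset.exists_cons_of_mem hi⟩
    obtain ⟨j, t, rfl⟩ : ∃ j t', t = j ::ₘ t' := by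
      obtain ⟨j, hj⟩ := Multiset.card_pos_iff_exists_mem.1 (by omega : 0 < Multiset.card t)
      exact ⟨j, Multiset.exists_cons_of_mem hj⟩
    obtain ⟨ℓ, hℓ, a, b, hab, h⟩ := ih s t (by simpa using hs) (by simpa using ht)
    by_cases hij : v i = v j
    · exact ⟨ℓ, by omega, a, b, hab, by simp [← h, hij]⟩
    · refine ⟨ℓ + 1, by omega, Fin.cons (v i) a, Fin.cons (v j) b, ?_, ?_⟩
      · exact Fin.cases ⟨⟨i, rfl⟩, ⟨j, rfl⟩, hij⟩ hab
      · rw [Fin.sum_univ_succ]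
        simp only [Fin.cons_zero, Fin.cons_succ, ← h, Multiset.map_cons, Multiset.sum_cons]
        abel

theorem khopSet_range (v : Fin m → G) (k : ℕ) :
    khopSet (Set.range v) k = (fun a : Fin m → ℤ => ∑ i, a i • v i) '' countDiffs m k \ {0} := by
  ext x
  constructor
  · rintro ⟨hx, ℓ, hℓ, a, b, hab, rfl⟩
    choose ha hb _ using hab
    choose p hp using ha
    choose q hq using hb
    refine ⟨⟨_, ⟨Finset.univ.val.map p, Finset.univ.val.map q, by simp, by simpa, rfl⟩, ?_⟩, hx⟩
    simp only [sum_count_sub_count_smul, Multiset.map_map, Function.comp_apply, hp, hq,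
      Finset.sum_sub_distrib, Finset.sum_map_val]
  · rintro ⟨⟨_, ⟨s, t, hst, hk, rfl⟩, rfl⟩, hx⟩
    obtain ⟨ℓ, hℓ, a, b, hab, h⟩ := exists_sum_sub_eq v _ s t rfl hst.symm
    exact ⟨hx, ℓ, hℓ.trans hk, a, b, hab, by simp only [sum_count_sub_count_smul, h]⟩

theorem Ck_range_eq_iff (v : Fin m → G) (k : ℕ) :
    Ck (Set.range v) k = ∑ i ∈ Finset.Icc 1 k, (H m i).ncard ↔
      Set.InjOn (fun a : Fin m → ℤ => ∑ i, a i • v i) (countDiffs m k) := by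
  have h0 := zero_mem_countDiffs m k
  have hfin := finite_countDiffs m k
  have h0' : (0 : G) ∈ (fun a : Fin m → ℤ => ∑ i, a i • v i) '' countDiffs m k :=
    ⟨0, h0, by simp⟩
  have hpos := (Set.ncard_pos hfin).2 ⟨_, h0⟩
  have hpos' := (Set.ncard_pos (hfin.image _)).2 ⟨_, h0'⟩
  rw [← Set.ncard_image_iff hfin, Ck, khopSet_range, Set.ncard_sdiff_singleton_of_mem h0',
    sum_ncard_H]
  omega

theorem IsBhSeq.eq_of_card_le {h : ℕ} {v : Fin m → G} (hv : IsBhSeq h v)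
    {s t : Multiset (Fin m)} (hst : Multiset.card s = Multiset.card t)
    (hs : Multiset.card s ≤ h) (hsum : (s.map v).sum = (t.map v).sum) : s = t := by
  rcases isEmpty_or_nonempty (Fin m) with _ | ⟨⟨i⟩⟩
  · exact Subsingleton.elim _ _
  · refine add_right_cancel (b := Multiset.replicate (h - Multiset.card s) i) (hv _ _ ?_ ?_ ?_)
    · simp; omega
    · simp; omega
    · simp [hsum]

theorem isBhSeq_two_mul_iff (v : Fin m → G) (k : ℕ) :
    IsBhSeq (2 * k) v ↔
      Set.InjOn (fun a : Fin m → ℤ => ∑ i, a i • v i) (countDiffs m k) := by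
  constructor
  · rintro hv _ ⟨s, t, hst, hs, rfl⟩ _ ⟨s', t', hst', hs', rfl⟩ h
    simp only [sum_count_sub_count_smul] at h
    have key : s + t' = s' + t := by
      refine hv.eq_of_card_le (by simp; omega) (by simp; omega) ?_
      simpa using sub_eq_sub_iff_add_eq_add.1 h
    ext i
    have := congrArg (Multiset.count i) key
    simp only [Multiset.count_add] at this
    omega
  · intro hinj s t hs ht hsum
    obtain ⟨s₁, s₂, rfl, hs₁, hs₂⟩ := exists_add_eq_of_card_eq_add (hs.trans (two_mul k))
    obtain ⟨t₁, t₂, rfl, ht₁, ht₂⟩ := exists_add_eq_of_card_eq_add (ht.trans (two_mul k))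
    have key := hinj ⟨s₁, t₁, by omega, by omega, rfl⟩ ⟨t₂, s₂, by omega, by omega, rfl⟩ (by
      simp only [sum_count_sub_count_smul]
      rw [sub_eq_sub_iff_add_eq_add]
      simpa [add_comm] using hsum)
    ext i
    have := congrFun key i
    simp only [Multiset.count_add]
    omega

theorem IsBhSeq.injective {h : ℕ} (hh : 1 ≤ h) {v : Fin m → G} (hv : IsBhSeq h v) :
    Function.Injective v := fun i j hij =>
  Multiset.singleton_inj.1 (hv.eq_of_card_le (by simp) (by simpa) (by simpa))

theorem IsBhSeq.hasDistinctDifferences {h : ℕ} (hh : 2 ≤ h) {v : Fin m → G}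
    (hv : IsBhSeq h v) : HasDistinctDifferences (Set.range v) := by
  rintro _ ⟨i, rfl⟩ _ ⟨j, rfl⟩ _ ⟨i', rfl⟩ _ ⟨j', rfl⟩ hij hij' hdiff
  have key : ({i, j'} : Multiset (Fin m)) = {i', j} :=
    hv.eq_of_card_le (by simp) (by simpa) (by simpa using sub_eq_sub_iff_add_eq_add.1 hdiff)
  have hi : i ∈ ({i', j} : Multiset (Fin m)) := by simp [← key]
  obtain rfl : i = i' := by
    rcases (by simpa using hi : i = i' ∨ i = j) with h | rfl
    · exact h
    · exact absurd rfl hij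
  exact ⟨rfl, by simpa using hdiff⟩

end

theorem stmt10 (k m : ℕ) (hk : 2 ≤ k) (v : Fin m → ℤ × ℤ) :
    IsBhSeq (2 * k) v ↔
      (Function.Injective v ∧ HasDistinctDifferences (Set.range v) ∧
        Ck (Set.range v) k = ∑ i ∈ Finset.Icc 1 k, (H m i).ncard) := by
  rw [Ck_range_eq_iff, ← isBhSeq_two_mul_iff]
  exact ⟨fun h => ⟨h.injective (by omega), h.hasDistinctDifferences (by omega), h⟩,
    fun h => h.2.2⟩
end

section
/- Let k ≥ 2 be an integer and let D be a set of m points in ℤ² whose pairwise differences between distinct points are all distinct (a DD(m)). Suppose D has two difference vectors d = v − w and d′ = v′ − w′ (with v ≠ w, v′ ≠ w′ in D) that are not parallel (not ℤ-linearly dependent as vectors in ℤ²). Then C_k(D) > k·m·(m−1). -/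
/-- Two vectors of ℤ² are parallel iff their cross product vanishes; for
nonzero vectors this is equivalent to one being a rational multiple of the
other. -/
def AreParallel (d d' : ℤ × ℤ) : Prop := d.1 * d'.2 = d.2 * d'.1

open scoped Pointwise

/-- A finite symmetric subset of an ordered group containing zero and two elements of different
archimedean classes has doubling at least two. -/
theorem two_mul_card_le_card_add_self {G : Type*} [AddCommGroup G] [LinearOrder G]
    [IsOrderedAddMonoid G] {S : Finset G} (hzero : 0 ∈ S) (hneg : ∀ x ∈ S, -x ∈ S) {d e : G}
    (hd : d ∈ S) (he : e ∈ S) (hd0 : 0 < d) (hde : ∀ n : ℕ, n • d < e) :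
    2 * S.card ≤ (S + S).card := by
  by_contra! hlt
  obtain ⟨a, haS, ha⟩ := S.exists_max_image id ⟨d, hd⟩
  simp only [id] at ha
  set U : Finset G := S.image (· + a) ∪ S.image (· - a) with hU
  have hUT : U ⊆ S + S := by
    intro x hx
    simp only [hU, Finset.mem_union, Finset.mem_image] at hx
    rcases hx with ⟨s, hs, rfl⟩ | ⟨s, hs, rfl⟩
    · exact Finset.add_mem_add hs haS
    · rw [sub_eq_add_neg]
      exact Finset.add_mem_add hs (hneg a haS)
  have hinter : S.image (· + a) ∩ S.image (· - a) ⊆ {0} := by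
    intro x hx
    simp only [Finset.mem_inter, Finset.mem_image] at hx
    obtain ⟨⟨s, hs, rfl⟩, t, ht, hts⟩ := hx
    have h1 : -s ≤ a := ha _ (hneg s hs)
    have h2 : t - a ≤ 0 := sub_nonpos.2 (ha t ht)
    rw [Finset.mem_singleton]
    exact le_antisymm (hts ▸ h2) (neg_le_iff_add_nonneg'.1 h1)
  have hcard := Finset.card_union_add_card_inter (S.image (· + a)) (S.image (· - a))
  rw [Finset.card_image_of_injective _ (add_left_injective a),
    Finset.card_image_of_injective _ sub_left_injective] at hcard
  have hone := Finset.card_le_card hinter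
  rw [Finset.card_singleton] at hone
  have hUeq : U = S + S := Finset.eq_of_subset_of_card_le hUT (by rw [← hU] at hcard; omega)
  have hpos : ∀ x ∈ S + S, 0 < x → x - a ∈ S := by
    intro x hx hx0
    rw [← hUeq] at hx
    simp only [hU, Finset.mem_union, Finset.mem_image] at hx
    rcases hx with ⟨s, hs, rfl⟩ | ⟨s, hs, rfl⟩
    · simpa using hs
    · exact absurd hx0 (not_lt.2 (sub_nonpos.2 (ha s hs)))
  have had : a - d ∈ S := by
    have := hneg _ (hpos d (by simpa using Finset.add_mem_add hd hzero) hd0)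
    simpa using this
  have hall : ∀ n : ℕ, e - n • d ∈ S := by
    intro n
    induction n with
    | zero => simpa using he
    | succ n ih =>
      have := hpos _ (Finset.add_mem_add ih had)
        (add_pos_of_pos_of_nonneg (sub_pos.2 (hde n)) (sub_nonneg.2 (ha d hd)))
      rw [succ_nsmul]
      convert this using 1
      abel
  refine Set.infinite_of_injective_forall_mem (f := fun n : ℕ => e - n • d) ?_ hall S.finite_toSet
  intro n n' h
  exact (nsmul_left_strictMono hd0).injective (sub_right_injective h)

/-- `k`-fold sumset bound for a finite set of at least doubling two in a torsion-free group. -/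
theorem mul_card_le_card_nsmul {G : Type*} [AddCommGroup G] [DecidableEq G] [IsAddTorsionFree G]
    {S : Finset G} (hS : S.Nonempty) (h2 : 2 * S.card ≤ (S + S).card) {k : ℕ} (hk : 2 ≤ k) :
    k * (S.card - 1) + 2 ≤ (k • S).card := by
  have hc := hS.card_pos
  induction k, hk using Nat.le_induction with
  | base => rw [two_nsmul]; omega
  | succ k hk ih =>
    have h := cauchy_davenport_of_isAddTorsionFree (s := k • S) (t := S) hS.nsmul hS
    rw [succ_nsmul, add_mul, one_mul]
    omega

/-- The `k`-hop set of `D` is the `k`-fold sumset of its difference set, without zero. -/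
theorem khopSet_eq_erase_nsmul {G : Type*} [AddCommGroup G] [DecidableEq G] {D : Finset G}
    (hD : D.Nonempty) (k : ℕ) :
    khopSet (D : Set G) k = ((k • (D - D)).erase 0 : Finset G) := by
  have hzero : (0 : G) ∈ D - D := by
    obtain ⟨x, hx⟩ := hD
    simpa using Finset.sub_mem_sub hx hx
  ext x
  simp only [khopSet, Set.mem_ofPred_eq, Finset.coe_erase, Set.mem_sdiff, Set.mem_singleton_iff,
    Finset.mem_coe]
  rw [and_comm]
  refine and_congr_left fun hx0 => ⟨?_, ?_⟩
  · rintro ⟨ℓ, hℓ, a, b, hab, rfl⟩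
    refine Finset.nsmul_subset_nsmul_right hzero hℓ ?_
    have h : ∀ n : ℕ, ∀ f : Fin n → G, (∀ i, f i ∈ D - D) → ∑ i, f i ∈ n • (D - D) := by
      intro n
      induction n with
      | zero => simp
      | succ n ih =>
        intro f hf
        rw [Fin.sum_univ_castSucc, succ_nsmul]
        exact Finset.add_mem_add (ih _ fun i => hf _) (hf _)
    exact h ℓ _ fun i => Finset.sub_mem_sub (hab i).1 (hab i).2.1
  · clear hx0
    induction k generalizing x with
    | zero =>
      intro hx
      refine ⟨0, le_rfl, Fin.elim0, Fin.elim0, fun i => i.elim0, ?_⟩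
      simpa using hx
    | succ k ih =>
      intro hx
      rw [succ_nsmul'] at hx
      obtain ⟨y, hy, z, hz, rfl⟩ := Finset.mem_add.1 hx
      obtain ⟨u, hu, v, hv, rfl⟩ := Finset.mem_sub.1 hy
      obtain ⟨ℓ, hℓ, a, b, hab, rfl⟩ := ih z hz
      by_cases huv : u = v
      · exact ⟨ℓ, hℓ.trans k.le_succ, a, b, hab, by simp [huv]⟩
      · refine ⟨ℓ + 1, Nat.succ_le_succ hℓ, Fin.cons u a, Fin.cons v b, ?_, ?_⟩
        · intro i
          refine Fin.cases ?_ (fun j => ?_) i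
          · exact ⟨hu, hv, huv⟩
          · exact hab j
        · rw [Fin.sum_univ_succ]
          rfl

theorem HasDistinctDifferences.card_sub_self {G : Type*} [AddCommGroup G] [DecidableEq G]
    {D : Finset G} (hD : D.Nonempty) (h : HasDistinctDifferences (D : Set G)) :
    (D - D).card = D.card * (D.card - 1) + 1 := by
  have hEq : D - D = insert 0 (D.offDiag.image fun p => p.1 - p.2) := by
    ext x
    simp only [Finset.mem_sub, Finset.mem_insert, Finset.mem_image, Finset.mem_offDiag,
      Prod.exists]
    constructor
    · rintro ⟨u, hu, v, hv, rfl⟩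
      by_cases huv : u = v
      · exact Or.inl (sub_eq_zero.2 huv)
      · exact Or.inr ⟨u, v, ⟨hu, hv, huv⟩, rfl⟩
    · rintro (rfl | ⟨u, v, ⟨hu, hv, -⟩, rfl⟩)
      · obtain ⟨u, hu⟩ := hD
        exact ⟨u, hu, u, hu, sub_self u⟩
      · exact ⟨u, hu, v, hv, rfl⟩
  rw [hEq, Finset.card_insert_of_notMem, Finset.card_image_of_injOn, Finset.offDiag_card,
    Nat.mul_sub_one]
  · rintro ⟨u, v⟩ huv ⟨u', v'⟩ huv' heq
    simp only [Finset.mem_coe, Finset.mem_offDiag] at huv huv'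
    have := h u huv.1 v huv.2.1 u' huv'.1 v' huv'.2.1 huv.2.2 huv'.2.2 heq
    exact Prod.ext this.1 this.2
  · simp only [Finset.mem_image, Finset.mem_offDiag, not_exists, not_and]
    rintro p ⟨-, -, hp⟩ h0
    exact hp (sub_eq_zero.1 h0)

/-- The coordinates of `x` across and along `d`, ordered lexicographically. -/
def crossDotHom (d : ℤ × ℤ) : ℤ × ℤ →+ ℤ ×ₗ ℤ where
  toFun x := toLex (d.1 * x.2 - d.2 * x.1, d.1 * x.1 + d.2 * x.2)
  map_zero' := by simp
  map_add' x y := by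
    rw [← toLex_add]
    congr 1
    ext <;> simp only [Prod.fst_add, Prod.snd_add] <;> ring

theorem crossDotHom_injective {d : ℤ × ℤ} (hd : d ≠ 0) : Function.Injective (crossDotHom d) := by
  have hpos : d.1 ^ 2 + d.2 ^ 2 ≠ 0 := by
    intro h
    apply hd
    ext
    · simpa using (by nlinarith [sq_nonneg d.1, sq_nonneg d.2] : d.1 ^ 2 = 0)
    · simpa using (by nlinarith [sq_nonneg d.1, sq_nonneg d.2] : d.2 ^ 2 = 0)
  rw [injective_iff_map_eq_zero]
  intro x hx
  have h := congrArg ofLex hx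
  simp only [crossDotHom, AddMonoidHom.coe_mk, ZeroHom.coe_mk, ofLex_toLex] at h
  have h1 : d.1 * x.2 - d.2 * x.1 = 0 := congrArg Prod.fst h
  have h2 : d.1 * x.1 + d.2 * x.2 = 0 := congrArg Prod.snd h
  ext
  · exact (mul_eq_zero.1 (by linear_combination d.1 * h2 - d.2 * h1 :
      (d.1 ^ 2 + d.2 ^ 2) * x.1 = 0)).resolve_left hpos
  · exact (mul_eq_zero.1 (by linear_combination d.2 * h2 + d.1 * h1 :
      (d.1 ^ 2 + d.2 ^ 2) * x.2 = 0)).resolve_left hpos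

/-- A finite symmetric subset of `ℤ × ℤ` containing zero and not contained in a line has doubling at least two. -/
theorem two_mul_card_le_card_add_self_of_not_areParallel {S : Finset (ℤ × ℤ)}
    (hzero : 0 ∈ S) (hneg : ∀ x ∈ S, -x ∈ S) {d e : ℤ × ℤ} (hd : d ∈ S) (he : e ∈ S)
    (hde : ¬ AreParallel d e) :
    2 * S.card ≤ (S + S).card := by
  have hd0 : d ≠ 0 := by
    rintro rfl
    simp [AreParallel] at hde
  wlog hlt : 0 < d.1 * e.2 - d.2 * e.1 generalizing e
  · refine this (hneg e he) (by simpa [AreParallel] using hde) ?_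
    have : d.1 * e.2 - d.2 * e.1 ≠ 0 := sub_ne_zero.2 hde
    simp only [Prod.fst_neg, Prod.snd_neg]
    grind
  have hinj := crossDotHom_injective hd0
  have h := two_mul_card_le_card_add_self (S := S.image (crossDotHom d)) (d := crossDotHom d d)
    (e := crossDotHom d e) ?_ ?_ (Finset.mem_image_of_mem _ hd) (Finset.mem_image_of_mem _ he) ?_ ?_
  · rwa [← Finset.image_add, Finset.card_image_of_injective _ hinj,
      Finset.card_image_of_injective _ hinj] at h
  · exact Finset.mem_image.2 ⟨0, hzero, map_zero _⟩
  · simp only [Finset.mem_image]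
    rintro _ ⟨x, hx, rfl⟩
    exact ⟨-x, hneg x hx, map_neg _ x⟩
  · refine lt_of_le_of_ne ?_ fun h => hd0 (hinj (h.symm.trans (map_zero _).symm))
    refine Prod.Lex.le_iff.2 (Or.inr ⟨?_, ?_⟩)
    · simp [crossDotHom, mul_comm d.1]
    · simpa [crossDotHom] using add_nonneg (mul_self_nonneg d.1) (mul_self_nonneg d.2)
  · intro n
    rw [← map_nsmul]
    refine Prod.Lex.lt_iff.2 (Or.inl ?_)
    have : d.1 * (n * d.2) - d.2 * (n * d.1) = 0 := by ring
    simpa [crossDotHom, this] using hlt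

theorem stmt15 (m k : ℕ) (hk : 2 ≤ k) (D : Finset (ℤ × ℤ)) (hcard : D.card = m)
    (hdd : HasDistinctDifferences (↑D : Set (ℤ × ℤ)))
    (v w v' w' : ℤ × ℤ) (hv : v ∈ D) (hw : w ∈ D) (hv' : v' ∈ D) (hw' : w' ∈ D)
    (hvw : v ≠ w) (hvw' : v' ≠ w')
    (hnp : ¬ AreParallel (v - w) (v' - w')) :
    k * m * (m - 1) < Ck (↑D : Set (ℤ × ℤ)) k := by
  have hD : D.Nonempty := ⟨v, hv⟩
  have hzero : (0 : ℤ × ℤ) ∈ D - D := by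
    simpa using Finset.sub_mem_sub hv hv
  have hneg : ∀ x ∈ D - D, -x ∈ D - D := by
    intro x hx
    obtain ⟨a, ha, b, hb, rfl⟩ := Finset.mem_sub.1 hx
    rw [neg_sub]
    exact Finset.sub_mem_sub hb ha
  have h2 := two_mul_card_le_card_add_self_of_not_areParallel hzero hneg (Finset.sub_mem_sub hv hw)
    (Finset.sub_mem_sub hv' hw') hnp
  have h := mul_card_le_card_nsmul (hD.sub hD) h2 hk
  rw [hdd.card_sub_self hD, Nat.add_sub_cancel, hcard, ← mul_assoc] at h
  rw [Ck, khopSet_eq_erase_nsmul hD, Set.ncard_coe_finset]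
  have := Finset.pred_card_le_card_erase (s := k • (D - D)) (a := 0)
  omega
end
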